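/- arXiv:2203.02509 — 2 statements merged into one kernel-verified Lean document; each statement's English description precedes it below -/
import Mathlib

section
/- Let q be a positive integer, c ∈ (−1,0), and ξ ∈ ℂ. Define J = −e^{iπ/4} ∫_{-∞}^{∞} e^{iπ q (x(t) − ξ)²} / (1 − e^{-2πi x(t)}) dt, where x(t) = c + e^{iπ/4} t. Then J · (1 − e^{-iπ q (1 − 2ξ)}) = −e^{-iπ q (1 − 2ξ)} e^{iπ q ξ²} + e^{iπ/4} q^{-1/2} Σ_{k=1}^{q} e^{-iπ k²/q + 2πi k ξ}. -/
open Real Set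
open Complex (I)

/-- The contour integral
`J = -e^{iπ/4} ∫_ℝ e^{iπq(x(t)-ξ)²}/(1 - e^{-2πix(t)}) dt`
along the line `x(t) = c + e^{iπ/4}t` crossing the real axis at `c`, traversed
downward from the first quadrant to the third quadrant. -/
noncomputable def siegelJ (q : ℝ) (ξ : ℂ) (c : ℝ) : ℂ :=
  -(Complex.exp (I * (π : ℂ) / 4) *
    ∫ t : ℝ,
      Complex.exp (I * (π : ℂ) * (q : ℂ)
          * (((c : ℂ) + Complex.exp (I * (π : ℂ) / 4) * (t : ℂ)) - ξ) ^ 2) /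
        (1 - Complex.exp (-(2 * (π : ℂ) * I
            * ((c : ℂ) + Complex.exp (I * (π : ℂ) / 4) * (t : ℂ))))))

open Filter Topology MeasureTheory

theorem add_mul_I_ne_zero {y : ℝ} (hy : y ≠ 0) (t : ℝ) : (t : ℂ) + y * I ≠ 0 := by
  intro h
  simpa [hy] using congrArg Complex.im h

theorem continuous_inv_add_mul_I {y : ℝ} (hy : y ≠ 0) :
    Continuous fun t : ℝ => ((t : ℂ) + y * I)⁻¹ :=
  Continuous.inv₀ (by fun_prop) (add_mul_I_ne_zero hy)

/-- The integral of `1/z` over a symmetric horizontal segment off the real axis. -/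
theorem integral_inv_add_mul_I {y : ℝ} (hy : y ≠ 0) (R : ℝ) :
    ∫ t : ℝ in -R..R, ((t : ℂ) + y * I)⁻¹ = -(2 * I * (arctan (R / y) : ℝ)) := by
  have hpos (t : ℝ) : 0 < t ^ 2 + y ^ 2 := by positivity
  have hderiv : ∀ t ∈ uIcc (-R) R, HasDerivAt
      (fun t : ℝ => ((Real.log (t ^ 2 + y ^ 2) / 2 : ℝ) : ℂ) - I * (arctan (t / y) : ℝ))
      (((t : ℂ) + y * I)⁻¹) t := by
    intro t _
    have h₁ : HasDerivAt (fun t : ℝ => Real.log (t ^ 2 + y ^ 2) / 2) (t / (t ^ 2 + y ^ 2)) t :=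
      ((((hasDerivAt_pow 2 t).add_const (y ^ 2)).log (hpos t).ne').div_const 2).congr_deriv
        (by simp; ring)
    have h₂ : HasDerivAt (fun t : ℝ => arctan (t / y)) (y / (t ^ 2 + y ^ 2)) t := by
      refine ((hasDerivAt_id' t).div_const y).arctan.congr_deriv ?_
      have h := (hpos t).ne'
      rw [add_comm] at h
      rw [add_comm (t ^ 2)]
      field_simp
    refine (h₁.ofReal_comp.sub (h₂.ofReal_comp.const_mul I)).congr_deriv ?_
    have h₃ : (t : ℂ) ^ 2 + y ^ 2 ≠ 0 := by exact_mod_cast (hpos t).ne'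
    refine eq_inv_of_mul_eq_one_left ?_
    push_cast
    field_simp
    linear_combination (-(y : ℂ) ^ 2) * Complex.I_sq
  rw [intervalIntegral.integral_eq_sub_of_hasDerivAt hderiv
    ((continuous_inv_add_mul_I hy).intervalIntegrable _ _)]
  simp only [neg_sq, neg_div, arctan_neg]
  push_cast
  ring

theorem tendsto_integral_inv_add_mul_I_of_pos {y : ℝ} (hy : 0 < y) :
    Tendsto (fun R : ℝ => ∫ t : ℝ in -R..R, ((t : ℂ) + y * I)⁻¹) atTop (𝓝 (-(π * I))) := by
  simp only [integral_inv_add_mul_I hy.ne']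
  have h := (tendsto_nhds_of_tendsto_nhdsWithin tendsto_arctan_atTop).comp
    (tendsto_id.atTop_div_const hy)
  have h' := ((Complex.continuous_ofReal.tendsto _).comp h).const_mul (2 * I) |>.neg
  refine h'.congr' (.of_forall fun R => rfl) |>.trans_eq ?_
  push_cast
  ring_nf

theorem tendsto_integral_inv_add_mul_I_of_neg {y : ℝ} (hy : y < 0) :
    Tendsto (fun R : ℝ => ∫ t : ℝ in -R..R, ((t : ℂ) + y * I)⁻¹) atTop (𝓝 (π * I)) := by
  simp only [integral_inv_add_mul_I hy.ne]
  have h := (tendsto_nhds_of_tendsto_nhdsWithin tendsto_arctan_atBot).comp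
    (tendsto_id.atTop_div_const_of_neg hy)
  have h' := ((Complex.continuous_ofReal.tendsto _).comp h).const_mul (2 * I) |>.neg
  refine h'.congr' (.of_forall fun R => rfl) |>.trans_eq ?_
  push_cast
  ring_nf

/-- Residue theorem for a horizontal strip with a single simple pole at the origin. -/
theorem integral_strip_sub_integral_strip {Φ : ℂ → ℂ} {s : Set ℂ} {a b : ℝ} {g : ℝ → ℝ}
    (ha : a < 0) (hb : 0 < b) (hs : IsOpen s) (hsub : {z : ℂ | z.im ∈ Icc a b} ⊆ s)
    (hΦ : DifferentiableOn ℂ Φ s)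
    (hia : Integrable fun t : ℝ => Φ (t + a * I) / (t + a * I))
    (hib : Integrable fun t : ℝ => Φ (t + b * I) / (t + b * I))
    (hg : Tendsto g atTop (𝓝 0))
    (hbound : ∀ᶠ R : ℝ in atTop, ∀ y ∈ Icc a b, ∀ t : ℝ, |t| = R →
      ‖Φ (t + y * I) / (t + y * I)‖ ≤ g R) :
    (∫ t : ℝ, Φ (t + a * I) / (t + a * I)) - ∫ t : ℝ, Φ (t + b * I) / (t + b * I)
      = 2 * π * I * Φ 0 := by
  have h0 : s ∈ 𝓝 (0 : ℂ) := hs.mem_nhds (hsub (by simp [ha.le, hb.le]))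
  have hG : DifferentiableOn ℂ (dslope Φ 0) s := (Complex.differentiableOn_dslope h0).2 hΦ
  have hGeq {z : ℂ} (hz : z ≠ 0) : dslope Φ 0 z = Φ z / z - Φ 0 * z⁻¹ := by
    rw [dslope_of_ne _ hz, slope_def_field]
    field_simp
    simp
  have hhor {y : ℝ} (hy : y ≠ 0)
      (hi : Integrable fun t : ℝ => Φ (t + y * I) / (t + y * I)) (R : ℝ) :
      ∫ t : ℝ in -R..R, dslope Φ 0 (t + y * I)
        = (∫ t : ℝ in -R..R, Φ (t + y * I) / (t + y * I))
          - Φ 0 * ∫ t : ℝ in -R..R, ((t : ℂ) + y * I)⁻¹ := by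
    simp only [hGeq (add_mul_I_ne_zero hy _)]
    rw [intervalIntegral.integral_sub hi.intervalIntegrable
      (((continuous_inv_add_mul_I hy).const_mul _).intervalIntegrable _ _),
      intervalIntegral.integral_const_mul]
  have hver {σ : ℝ → ℝ} (hσ : ∀ R, 0 < R → |σ R| = R) :
      Tendsto (fun R : ℝ => ∫ y : ℝ in a..b, dslope Φ 0 (σ R + y * I)) atTop (𝓝 0) := by
    have hlim : Tendsto (fun R : ℝ => (g R + ‖Φ 0‖ * R⁻¹) * |b - a|) atTop (𝓝 0) := by
      simpa using (hg.add (tendsto_inv_atTop_zero.const_mul ‖Φ 0‖)).mul_const |b - a|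
    refine squeeze_zero_norm' ?_ hlim
    filter_upwards [hbound, eventually_gt_atTop 0] with R hR hR0
    refine intervalIntegral.norm_integral_le_of_norm_le_const fun y hy => ?_
    rw [uIoc_of_le (ha.trans hb).le] at hy
    have hre : R ≤ ‖(σ R : ℂ) + y * I‖ := by
      simpa [hσ R hR0] using Complex.abs_re_le_norm ((σ R : ℂ) + y * I)
    rw [hGeq (norm_pos_iff.1 (hR0.trans_le hre))]
    refine (norm_sub_le _ _).trans (add_le_add (hR y (Ioc_subset_Icc_self hy) _ (hσ R hR0)) ?_)
    rw [norm_mul, norm_inv]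
    gcongr
  have hrect (R : ℝ) := Complex.integral_boundary_rect_eq_zero_of_differentiableOn (dslope Φ 0)
    (-R + a * I) (R + b * I) (hG.mono fun z hz => hsub (by
      have := hz.2
      simpa [uIcc_of_le (ha.trans hb).le] using this))
  have hlim := ((((intervalIntegral_tendsto_integral hia tendsto_neg_atTop_atBot tendsto_id).sub
      ((tendsto_integral_inv_add_mul_I_of_neg ha).const_mul (Φ 0))).sub
    ((intervalIntegral_tendsto_integral hib tendsto_neg_atTop_atBot tendsto_id).sub
      ((tendsto_integral_inv_add_mul_I_of_pos hb).const_mul (Φ 0)))).add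
    ((hver (σ := fun R => R) fun R hR => abs_of_pos hR).const_smul I)).sub
    ((hver (σ := fun R => -R) fun R hR => by rw [abs_neg, abs_of_pos hR]).const_smul I)
  have hzero := tendsto_nhds_unique hlim ((tendsto_const_nhds (x := (0 : ℂ))).congr fun R =>
    (hrect R).symm.trans (by simp [hhor ha.ne hia, hhor hb.ne' hib]))
  simp only [smul_zero, add_zero, sub_zero] at hzero
  linear_combination hzero

theorem exp_I_mul_pi_div_four :
    Complex.exp (I * π / 4) = ((√2 / 2 : ℝ) : ℂ) + ((√2 / 2 : ℝ) : ℂ) * I := by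
  rw [show I * (π : ℂ) / 4 = ((π / 4 : ℝ) : ℂ) * I by push_cast; ring, Complex.exp_mul_I,
    ← Complex.ofReal_cos, ← Complex.ofReal_sin, cos_pi_div_four, sin_pi_div_four]

theorem exp_I_mul_pi_div_four_sq : Complex.exp (I * π / 4) ^ 2 = I := by
  rw [← Complex.exp_nat_mul]
  refine Eq.trans ?_ Complex.exp_pi_div_two_mul_I
  congr 1
  push_cast
  ring

theorem exp_I_mul_pi_div_four_mul (t y : ℝ) :
    Complex.exp (I * π / 4) * (t + y * I)
      = ((√2 / 2 * (t - y) : ℝ) : ℂ) + ((√2 / 2 * (t + y) : ℝ) : ℂ) * I := by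
  rw [exp_I_mul_pi_div_four]
  push_cast
  linear_combination (√2 / 2 * y : ℂ) * Complex.I_sq

/-- The integrand defining `siegelJ`. -/
noncomputable def siegelIntegrand (q : ℝ) (ξ x : ℂ) : ℂ :=
  Complex.exp (I * π * q * (x - ξ) ^ 2) / (1 - Complex.exp (-(2 * π * I * x)))

theorem one_sub_exp_ne_zero {a b : ℝ} (ha : -1 < a) (hb : b < 1) {u : ℂ}
    (hu : u.im ∈ Icc (√2 / 2 * a) (√2 / 2 * b)) (hu0 : u ≠ 0) :
    1 - Complex.exp (-(2 * π * I * (Complex.exp (I * π / 4) * u))) ≠ 0 := by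
  intro h
  obtain ⟨n, hn⟩ := Complex.exp_eq_one_iff.1 (sub_eq_zero.1 h).symm
  have hs : (0 : ℝ) < √2 / 2 := by positivity
  have hs2 : √2 * √2 = 2 := mul_self_sqrt (by norm_num)
  have hω : Complex.exp (I * π / 4) * u = ((-n : ℝ) : ℂ) := by
    have h2 : (2 * π * I : ℂ) ≠ 0 := Complex.two_pi_I_ne_zero
    apply mul_left_cancel₀ h2
    push_cast
    linear_combination -hn
  rw [← Complex.re_add_im u, exp_I_mul_pi_div_four_mul] at hω
  have hre : √2 / 2 * (u.re - u.im) = -n := by simpa using congrArg Complex.re hω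
  have him : u.re + u.im = 0 := by simpa using congrArg Complex.im hω
  have hn' : u.im = √2 / 2 * n := by
    linear_combination (-√2 / 2) * hre + u.re / 2 * hs2 / 2 - u.im / 2 * hs2 / 2 + him / 2
  rw [hn', mem_Icc, mul_le_mul_iff_right₀ hs, mul_le_mul_iff_right₀ hs] at hu
  have hn1 : -1 < n := by exact_mod_cast ha.trans_le hu.1
  have hn2 : n < 1 := by exact_mod_cast hu.2.trans_lt hb
  obtain rfl : n = 0 := by omega
  simp at hn'
  refine hu0 (Complex.ext ?_ hn')
  simpa [hn'] using him

theorem half_le_norm_one_sub_exp {t y : ℝ} (ht : 2 ≤ |t|) (hy : |y| ≤ 1) :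
    1 / 2 ≤ ‖1 - Complex.exp (-(2 * π * I * (Complex.exp (I * π / 4) * (t + y * I))))‖ := by
  have hnorm : ‖Complex.exp (-(2 * π * I * (Complex.exp (I * π / 4) * (t + y * I))))‖
      = rexp (π * √2 * (t + y)) := by
    rw [exp_I_mul_pi_div_four_mul, Complex.norm_exp]
    congr 1
    simp
    ring
  have hc : 1 ≤ π * √2 := by
    have h1 : 1 ≤ √2 := by rw [one_le_sqrt]; norm_num
    nlinarith [pi_gt_three]
  obtain ⟨hy1, hy2⟩ := abs_le.1 hy
  rcases le_abs.1 ht with ht | ht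
  · have h : 2 ≤ rexp (π * √2 * (t + y)) := by
      have := add_one_le_exp (π * √2 * (t + y))
      nlinarith
    have := norm_sub_norm_le
      (Complex.exp (-(2 * π * I * (Complex.exp (I * π / 4) * (t + y * I))))) 1
    rw [norm_sub_rev, hnorm, norm_one] at this
    linarith
  · have h : rexp (π * √2 * (t + y)) ≤ 1 / 2 := by
      have h2 : 2 ≤ rexp (-(π * √2 * (t + y))) := by
        have := add_one_le_exp (-(π * √2 * (t + y)))
        nlinarith
      rw [exp_neg] at h2
      rw [one_div]
      exact le_inv_of_le_inv₀ (by positivity) h2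
    have := norm_sub_norm_le (1 : ℂ)
      (Complex.exp (-(2 * π * I * (Complex.exp (I * π / 4) * (t + y * I)))))
    rw [hnorm, norm_one] at this
    linarith

theorem exists_norm_exp_sq_le {q : ℝ} (hq : 1 ≤ q) (ξ : ℂ) :
    ∃ K : ℝ, 0 ≤ K ∧ ∀ t y : ℝ, |y| ≤ 1 →
      ‖Complex.exp (I * π * q * (Complex.exp (I * π / 4) * (t + y * I) - ξ) ^ 2)‖
        ≤ K * rexp (-t ^ 2) := by
  obtain ⟨a, b⟩ := ξ
  set M : ℝ := (a + b) ^ 2 + 2 + (a - b) ^ 2 + 2 * |a * b| with hM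
  refine ⟨rexp (π * q * M), (exp_pos _).le, fun t y hy => ?_⟩
  rw [exp_I_mul_pi_div_four_mul, Complex.norm_exp, ← Real.exp_add, Real.exp_le_exp]
  have hre : (I * π * q * ((((√2 / 2 * (t - y) : ℝ) : ℂ)
      + ((√2 / 2 * (t + y) : ℝ) : ℂ) * I - (⟨a, b⟩ : ℂ)) ^ 2)).re
      = -(π * q * (2 * ((√2 / 2 * (t - y) - a) * (√2 / 2 * (t + y) - b)))) := by
    simp [sq]
    left
    ring
  have hy2 : y ^ 2 ≤ 1 := by rwa [sq_le_one_iff_abs_le_one]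
  have hs2 : √2 ^ 2 = 2 := sq_sqrt (by norm_num)
  have hmain : t ^ 2 / 2 - M ≤ 2 * ((√2 / 2 * (t - y) - a) * (√2 / 2 * (t + y) - b)) := by
    have h1 := sq_nonneg (t - √2 * (a + b))
    have h2 := sq_nonneg (√2 * y - (a - b))
    have h3 := neg_abs_le (a * b)
    have e : 2 * ((√2 / 2 * (t - y) - a) * (√2 / 2 * (t + y) - b))
      = t ^ 2 - y ^ 2 - √2 * (a + b) * t - √2 * (a - b) * y + 2 * (a * b) := by
      linear_combination ((t ^ 2 - y ^ 2) / 2) * hs2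
    rw [e]
    nlinarith
  have hpq : 2 ≤ π * q := by nlinarith [pi_gt_three]
  rw [hre]
  nlinarith [mul_le_mul_of_nonneg_left hmain (zero_le_two.trans hpq), sq_nonneg t]

theorem exists_norm_siegelIntegrand_le {q : ℝ} (hq : 1 ≤ q) (ξ : ℂ) :
    ∃ K : ℝ, ∀ t y : ℝ, 2 ≤ |t| → |y| ≤ 1 →
      ‖siegelIntegrand q ξ (Complex.exp (I * π / 4) * (t + y * I))‖ ≤ K * rexp (-t ^ 2) := by
  obtain ⟨K, hK0, hK⟩ := exists_norm_exp_sq_le hq ξ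
  refine ⟨2 * K, fun t y ht hy => ?_⟩
  have hden := half_le_norm_one_sub_exp ht hy
  rw [siegelIntegrand, norm_div, div_le_iff₀ (by linarith)]
  have := mul_le_mul_of_nonneg_left hden (mul_nonneg hK0 (exp_pos (-t ^ 2)).le)
  linarith [hK t y hy]

theorem integrable_siegelIntegrand {q : ℝ} (hq : 1 ≤ q) (ξ : ℂ) {y : ℝ} (hy : |y| ≤ 1)
    (hden : ∀ t : ℝ,
      1 - Complex.exp (-(2 * π * I * (Complex.exp (I * π / 4) * (t + y * I)))) ≠ 0) :
    Integrable fun t : ℝ => siegelIntegrand q ξ (Complex.exp (I * π / 4) * (t + y * I)) := by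
  obtain ⟨K, hK⟩ := exists_norm_siegelIntegrand_le hq ξ
  have hcont : Continuous fun t : ℝ =>
      siegelIntegrand q ξ (Complex.exp (I * π / 4) * (t + y * I)) :=
    Continuous.div (by fun_prop) (by fun_prop) hden
  have hgauss : Integrable fun t : ℝ => rexp (-t ^ 2) := by
    simpa using integrable_exp_neg_mul_sq one_pos
  refine hcont.locallyIntegrable.integrable_of_isBigO_atBot_atTop
    (.of_bound K ?_) (hgauss.integrableAtFilter _) (.of_bound K ?_) (hgauss.integrableAtFilter _)
  · filter_upwards [eventually_le_atBot (-2)] with t ht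
    rw [norm_of_nonneg (exp_pos _).le]
    exact hK t y (by rw [abs_of_neg (by linarith)]; linarith) hy
  · filter_upwards [eventually_ge_atTop 2] with t ht
    rw [norm_of_nonneg (exp_pos _).le]
    exact hK t y (ht.trans (le_abs_self t)) hy

theorem ofReal_add_exp_I_mul_pi_div_four_mul (c t : ℝ) :
    (c : ℂ) + Complex.exp (I * π / 4) * t
      = Complex.exp (I * π / 4) *
        (((t + √2 / 2 * c : ℝ) : ℂ) + ((√2 / 2 * -c : ℝ) : ℂ) * I) := by
  have hs2 : (√2 : ℂ) ^ 2 = 2 := by exact_mod_cast sq_sqrt (zero_le_two (α := ℝ))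
  rw [exp_I_mul_pi_div_four]
  push_cast
  linear_combination (√2 ^ 2 / 4 * c : ℂ) * Complex.I_sq - c / 2 * hs2

theorem integral_siegelIntegrand_translate (q : ℝ) (ξ : ℂ) (c : ℝ) :
    ∫ t : ℝ, siegelIntegrand q ξ (c + Complex.exp (I * π / 4) * t)
      = ∫ t : ℝ, siegelIntegrand q ξ
          (Complex.exp (I * π / 4) * (t + ((√2 / 2 * -c : ℝ) : ℂ) * I)) := by
  simp only [ofReal_add_exp_I_mul_pi_div_four_mul]
  exact integral_add_right_eq_self (fun t : ℝ => siegelIntegrand q ξ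
    (Complex.exp (I * π / 4) * (t + ((√2 / 2 * -c : ℝ) : ℂ) * I))) (√2 / 2 * c)

theorem abs_sqrt_two_div_two_mul_le_one {c : ℝ} (hc : |c| ≤ 1) : |√2 / 2 * c| ≤ 1 := by
  have h2 : √2 ≤ 2 := by rw [sqrt_le_left] <;> norm_num
  rw [abs_mul, abs_of_nonneg (by positivity)]
  exact mul_le_one₀ (by linarith) (abs_nonneg c) hc

/-- Moving the line across the pole at the origin picks up the residue there. -/
theorem integral_siegelIntegrand_add_one_sub {q : ℝ} (hq : 1 ≤ q) (ξ : ℂ) {c : ℝ}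
    (hc : c ∈ Ioo (-1 : ℝ) 0) :
    Complex.exp (I * π / 4) *
      ((∫ t : ℝ, siegelIntegrand q ξ ((c + 1 : ℝ) + Complex.exp (I * π / 4) * t))
        - ∫ t : ℝ, siegelIntegrand q ξ (c + Complex.exp (I * π / 4) * t))
      = Complex.exp (I * π * q * ξ ^ 2) := by
  have hs : (0 : ℝ) < √2 / 2 := by positivity
  set ω := Complex.exp (I * π / 4) with hω
  have hω0 : ω ≠ 0 := Complex.exp_ne_zero _
  set a : ℝ := √2 / 2 * -(c + 1) with ha
  set b : ℝ := √2 / 2 * -c with hb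
  have ha0 : a < 0 := mul_neg_of_pos_of_neg hs (by linarith [hc.1])
  have hb0 : 0 < b := mul_pos hs (by linarith [hc.2])
  have ha1 : |a| ≤ 1 :=
    abs_sqrt_two_div_two_mul_le_one (by rw [abs_le]; constructor <;> linarith [hc.1, hc.2])
  have hb1 : |b| ≤ 1 :=
    abs_sqrt_two_div_two_mul_le_one (by rw [abs_le]; constructor <;> linarith [hc.1, hc.2])
  set D : ℂ → ℂ := fun u => 1 - Complex.exp (-(2 * π * I * (ω * u))) with hD
  have hDdiff : Differentiable ℂ D := by fun_prop
  have hDne {u : ℂ} (hu : u.im ∈ Icc a b) (hu0 : u ≠ 0) : D u ≠ 0 :=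
    one_sub_exp_ne_zero (by linarith [hc.2]) (by linarith [hc.1]) hu hu0
  have hD0 : D 0 = 0 := by simp [hD]
  have hDderiv : deriv D 0 = 2 * π * I * ω := by
    have h : HasDerivAt D (-(Complex.exp (-(2 * π * I * (ω * 0))) * -(2 * π * I * (ω * 1)))) 0 :=
      ((((hasDerivAt_id' (0 : ℂ)).const_mul ω).const_mul (2 * π * I)).fun_neg.cexp).const_sub 1
    rw [h.deriv]
    simp
  have hd : Differentiable ℂ (dslope D 0) :=
    differentiableOn_univ.1 ((Complex.differentiableOn_dslope univ_mem).2 hDdiff.differentiableOn)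
  have hdD (u : ℂ) : dslope D 0 u * u = D u := by
    simpa [hD0, mul_comm] using sub_smul_dslope D 0 u
  have hd0 : dslope D 0 0 = 2 * π * I * ω := by rw [dslope_same, hDderiv]
  set Φ : ℂ → ℂ := fun u => Complex.exp (I * π * q * (ω * u - ξ) ^ 2) / dslope D 0 u with hΦ
  have hΦF (u : ℂ) : Φ u / u = siegelIntegrand q ξ (ω * u) := by
    rw [hΦ, siegelIntegrand, div_div, hdD]
  have hline {y : ℝ} (hy : y ∈ Icc a b) (hy0 : y ≠ 0) (hy1 : |y| ≤ 1) :
      Integrable fun t : ℝ => Φ (t + y * I) / (t + y * I) := by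
    simp only [hΦF]
    exact integrable_siegelIntegrand hq ξ hy1 fun t =>
      hDne (by simpa using hy) (add_mul_I_ne_zero hy0 t)
  obtain ⟨K, hK⟩ := exists_norm_siegelIntegrand_le hq ξ
  have hlim : Tendsto (fun R : ℝ => K * rexp (-R ^ 2)) atTop (𝓝 0) := by
    simpa using (tendsto_exp_neg_atTop_nhds_zero.comp
      (tendsto_pow_atTop (two_ne_zero (α := ℕ)))).const_mul K
  have hres := integral_strip_sub_integral_strip (Φ := Φ) (s := {u | dslope D 0 u ≠ 0}) ha0 hb0
    (isOpen_ne_fun hd.continuous continuous_const)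
    (fun u hu => by
      rcases eq_or_ne u 0 with rfl | hu0
      · exact hd0.trans_ne (mul_ne_zero Complex.two_pi_I_ne_zero hω0)
      · exact left_ne_zero_of_mul (hdD u ▸ hDne hu hu0))
    (DifferentiableOn.div (by fun_prop) hd.differentiableOn fun u hu => hu)
    (hline (left_mem_Icc.2 (ha0.trans hb0).le) ha0.ne ha1)
    (hline (right_mem_Icc.2 (ha0.trans hb0).le) hb0.ne' hb1) hlim (by
      filter_upwards [eventually_ge_atTop 2] with R hR y hy t ht
      rw [hΦF, ← ht, sq_abs]
      exact hK t y (ht ▸ hR) (abs_le.2 ⟨(neg_le_of_abs_le ha1).trans hy.1,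
        hy.2.trans (le_of_abs_le hb1)⟩))
  simp only [hΦF] at hres
  rw [integral_siegelIntegrand_translate, integral_siegelIntegrand_translate, ← hω, ← ha, ← hb,
    hres, hΦ]
  have hπ : (π : ℂ) ≠ 0 := Complex.ofReal_ne_zero.2 pi_ne_zero
  simp only [hd0]
  field_simp
  simp

theorem one_sub_exp_line_ne_zero {c : ℝ} (hc : c ∈ Ioo (-1 : ℝ) 0) (t : ℝ) :
    1 - Complex.exp (-(2 * π * I * (c + Complex.exp (I * π / 4) * t))) ≠ 0 := by
  rw [ofReal_add_exp_I_mul_pi_div_four_mul]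
  refine one_sub_exp_ne_zero (a := -c) (b := -c) (by linarith [hc.2]) (by linarith [hc.1])
    (by simp) (add_mul_I_ne_zero ?_ _)
  exact mul_ne_zero (by positivity) (neg_ne_zero.2 hc.2.ne)

theorem integrable_siegelIntegrand_line {q : ℝ} (hq : 1 ≤ q) (ξ : ℂ) {c : ℝ}
    (hc : c ∈ Ioo (-1 : ℝ) 0) :
    Integrable fun t : ℝ => siegelIntegrand q ξ (c + Complex.exp (I * π / 4) * t) := by
  have hy : |√2 / 2 * -c| ≤ 1 :=
    abs_sqrt_two_div_two_mul_le_one (by rw [abs_le]; constructor <;> linarith [hc.1, hc.2])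
  have h := integrable_siegelIntegrand hq ξ hy fun t => by
    have := one_sub_exp_line_ne_zero hc (t - √2 / 2 * c)
    rwa [ofReal_add_exp_I_mul_pi_div_four_mul, sub_add_cancel] at this
  simp only [ofReal_add_exp_I_mul_pi_div_four_mul]
  exact h.comp_add_right (√2 / 2 * c)

theorem siegelIntegrand_add_one (q : ℕ) (ξ : ℂ) {x : ℂ}
    (hx : 1 - Complex.exp (-(2 * π * I * x)) ≠ 0) :
    siegelIntegrand q ξ (x + 1) = Complex.exp (I * π * q * (1 - 2 * ξ)) *
      (siegelIntegrand q ξ x +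
        ∑ k ∈ Finset.Icc 1 q, Complex.exp (I * π * q * (x - ξ) ^ 2 + 2 * π * I * k * x)) := by
  set w := Complex.exp (2 * π * I * x) with hw
  have hw0 : w ≠ 0 := Complex.exp_ne_zero _
  have hinv : Complex.exp (-(2 * π * I * x)) = w⁻¹ := Complex.exp_neg _
  have hshift : Complex.exp (-(2 * π * I * (x + 1))) = w⁻¹ := by
    rw [← hinv, ← Complex.exp_periodic.sub_eq (-(2 * π * I * x))]
    congr 1
    ring
  have hnum : Complex.exp (I * π * q * (x + 1 - ξ) ^ 2)
      = Complex.exp (I * π * q * (1 - 2 * ξ)) * Complex.exp (I * π * q * (x - ξ) ^ 2) * w ^ q := by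
    rw [hw, ← Complex.exp_nat_mul, ← Complex.exp_add, ← Complex.exp_add]
    congr 1
    ring
  have hsum : ∑ k ∈ Finset.Icc 1 q, Complex.exp (I * π * q * (x - ξ) ^ 2 + 2 * π * I * k * x)
      = Complex.exp (I * π * q * (x - ξ) ^ 2) * ∑ k ∈ Finset.Icc 1 q, w ^ k := by
    rw [Finset.mul_sum]
    refine Finset.sum_congr rfl fun k _ => ?_
    rw [hw, ← Complex.exp_nat_mul, ← Complex.exp_add]
    congr 1
    ring
  rw [hinv] at hx
  have hw1 : w ≠ 1 := by
    rintro h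
    simp [h] at hx
  have hgeom : ∑ k ∈ Finset.Icc 1 q, w ^ k = (w ^ q - 1) / (1 - w⁻¹) := by
    rw [← Finset.Ico_add_one_right_eq_Icc, geom_sum_Ico hw1 (by omega)]
    have := sub_ne_zero.2 hw1
    field_simp
    ring
  rw [siegelIntegrand, siegelIntegrand, hshift, hinv, hsum, hgeom]
  push_cast
  rw [hnum]
  field_simp
  ring

theorem exp_gaussian_line_eq (q : ℝ) (ξ : ℂ) (c : ℝ) (k : ℂ) (t : ℝ) :
    Complex.exp (I * π * q * (c + Complex.exp (I * π / 4) * t - ξ) ^ 2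
        + 2 * π * I * k * (c + Complex.exp (I * π / 4) * t))
      = Complex.exp ((-(π * q : ℝ) : ℂ) * t ^ 2
        + 2 * π * I * Complex.exp (I * π / 4) * (q * (c - ξ) + k) * t
        + (I * π * q * (c - ξ) ^ 2 + 2 * π * I * k * c)) := by
  congr 1
  push_cast
  linear_combination (I * π * q * t ^ 2) * exp_I_mul_pi_div_four_sq + π * q * t ^ 2 * Complex.I_sq

theorem integrable_gaussian_line {q : ℝ} (hq : 0 < q) (ξ : ℂ) (c : ℝ) (k : ℂ) :
    Integrable fun t : ℝ => Complex.exp (I * π * q * (c + Complex.exp (I * π / 4) * t - ξ) ^ 2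
        + 2 * π * I * k * (c + Complex.exp (I * π / 4) * t)) := by
  simp only [exp_gaussian_line_eq]
  exact integrable_cexp_quadratic' (by simp; positivity) _ _

theorem integral_gaussian_line {q : ℝ} (hq : 0 < q) (ξ : ℂ) (c : ℝ) (k : ℂ) :
    ∫ t : ℝ, Complex.exp (I * π * q * (c + Complex.exp (I * π / 4) * t - ξ) ^ 2
        + 2 * π * I * k * (c + Complex.exp (I * π / 4) * t))
      = ((1 / √q : ℝ) : ℂ) * Complex.exp (-(I * π * k ^ 2 / q) + 2 * π * I * k * ξ) := by
  simp only [exp_gaussian_line_eq]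
  have hπ : (π : ℂ) ≠ 0 := Complex.ofReal_ne_zero.2 pi_ne_zero
  have hq' : (q : ℂ) ≠ 0 := Complex.ofReal_ne_zero.2 hq.ne'
  rw [integral_cexp_quadratic (by simp; positivity)]
  congr 1
  · rw [neg_neg, ← Complex.ofReal_div, show π / (π * q) = 1 / q by field_simp,
      show (1 / 2 : ℂ) = ((1 / 2 : ℝ) : ℂ) by push_cast; rfl,
      ← Complex.ofReal_cpow (by positivity), ← sqrt_eq_rpow, sqrt_div zero_le_one, sqrt_one]
  · congr 1
    push_cast
    field_simp
    rw [exp_I_mul_pi_div_four_sq]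
    linear_combination (4 * (q * (c - ξ) + k) ^ 2) * Complex.I_sq

/-- **Functional equation for the integral `J`**: for a positive integer `q`,
`c ∈ (-1,0)` and `ξ ∈ ℂ`,
`J (1 - e^{-iπq(1-2ξ)}) = -e^{-iπq(1-2ξ)} e^{iπqξ²}
   + e^{iπ/4} q^{-1/2} Σ_{k=1}^q e^{-iπk²/q + 2πikξ}`. -/
theorem siegelJ_functional_equation (q : ℕ) (hq : 0 < q) (c : ℝ)
    (hc : c ∈ Ioo (-1 : ℝ) 0) (ξ : ℂ) :
    siegelJ (q : ℝ) ξ c *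
        (1 - Complex.exp (-(I * (π : ℂ) * (q : ℂ) * (1 - 2 * ξ))))
      = -(Complex.exp (-(I * (π : ℂ) * (q : ℂ) * (1 - 2 * ξ)))
            * Complex.exp (I * (π : ℂ) * (q : ℂ) * ξ ^ 2))
        + Complex.exp (I * (π : ℂ) / 4) * ((1 / Real.sqrt q : ℝ) : ℂ) *
            ∑ k ∈ Finset.Icc 1 q,
              Complex.exp (-(I * (π : ℂ) * (k : ℂ) ^ 2 / (q : ℂ))
                + 2 * (π : ℂ) * I * (k : ℂ) * ξ) := by
  have hq1 : (1 : ℝ) ≤ q := by exact_mod_cast hq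
  have hJ : siegelJ q ξ c = -(Complex.exp (I * π / 4) *
      ∫ t : ℝ, siegelIntegrand q ξ (c + Complex.exp (I * π / 4) * t)) := rfl
  have hres := integral_siegelIntegrand_add_one_sub hq1 ξ hc
  have hgauss (k : ℂ) := integrable_gaussian_line (zero_lt_one.trans_le hq1) ξ c k
  have hgaussint (k : ℂ) := integral_gaussian_line (zero_lt_one.trans_le hq1) ξ c k
  simp only [Complex.ofReal_natCast] at hres hgauss hgaussint
  have hshift : ∫ t : ℝ, siegelIntegrand q ξ ((c + 1 : ℝ) + Complex.exp (I * π / 4) * t)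
      = Complex.exp (I * π * q * (1 - 2 * ξ)) *
        ((∫ t : ℝ, siegelIntegrand q ξ (c + Complex.exp (I * π / 4) * t))
          + ((1 / √q : ℝ) : ℂ) * ∑ k ∈ Finset.Icc 1 q,
            Complex.exp (-(I * π * k ^ 2 / q) + 2 * π * I * k * ξ)) := by
    simp only [Complex.ofReal_add, Complex.ofReal_one, add_right_comm (c : ℂ) 1,
      siegelIntegrand_add_one q ξ (one_sub_exp_line_ne_zero hc _)]
    rw [integral_const_mul, integral_add (by exact integrable_siegelIntegrand_line hq1 ξ hc)
      (integrable_finsetSum _ fun (k : ℕ) _ => hgauss k),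
      integral_finsetSum _ fun (k : ℕ) _ => hgauss k, Finset.mul_sum]
    simp only [hgaussint]
  rw [hshift] at hres
  rw [hJ, ← hres, Complex.exp_neg]
  have hE := Complex.exp_ne_zero (I * π * q * (1 - 2 * ξ))
  field_simp
  ring
end

section
/- Let m be a positive integer and let k be an integer such that m + k is even. Then Σ_{n=1}^{m} e^{-iπ n²/m − iπ k n/m} = e^{(iπ/4)(k²/m − 1)} · √m, where √m is the positive real square root. -/
open Real
open Complex (I)
open Filter Topology

theorem norm_cexp_neg_quadratic (w : ℂ) (c : ℝ) (n : ℤ) :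
    ‖Complex.exp (-π * w * n ^ 2 + 2 * π * (-I * c) * n)‖ = rexp (-π * w.re * n ^ 2) := by
  rw [Complex.norm_exp]
  congr 1
  have h : (-π * w * n ^ 2 + 2 * π * (-I * c) * n : ℂ)
      = ((-π * n ^ 2 : ℝ) : ℂ) * w + ((-2 * π * c * n : ℝ) : ℂ) * I := by
    push_cast; ring
  rw [h, Complex.add_re, Complex.re_ofReal_mul, Complex.re_ofReal_mul, Complex.I_re]
  ring

theorem summable_exp_neg_mul_int_sq {a : ℝ} (ha : 0 < a) :
    Summable fun n : ℤ ↦ rexp (-π * a * n ^ 2) := by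
  simpa [mul_assoc] using summable_pow_mul_jacobiTheta₂_term_bound 0 ha 0

/-- As `re w → ∞`, a Gaussian sum of parameter `1 / w` is asymptotic to `w ^ (1 / 2)`. -/
theorem tendsto_tsum_exp_neg_div_mul_sq {ι : Type*} {l : Filter ι} {w : ι → ℂ}
    (hw : Tendsto (fun x ↦ (w x).re) l atTop) (c : ℝ) :
    Tendsto (fun x ↦ 1 / w x ^ (1 / 2 : ℂ) * ∑' n : ℤ, Complex.exp (-π / w x * (n + c) ^ 2))
      l (𝓝 1) := by
  have key : Tendsto
      (fun x ↦ ∑' n : ℤ, Complex.exp (-π * w x * n ^ 2 + 2 * π * (-I * c) * n)) l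
      (𝓝 (∑' n : ℤ, if n = 0 then 1 else 0)) := by
    refine tendsto_tsum_of_dominated_convergence (summable_exp_neg_mul_int_sq one_pos)
      (fun n ↦ ?_) ?_
    · split_ifs with hn
      · simp [hn, tendsto_const_nhds]
      · rw [tendsto_zero_iff_norm_tendsto_zero]
        simp_rw [norm_cexp_neg_quadratic]
        refine tendsto_exp_atBot.comp ?_
        have hn' : -π * (n : ℝ) ^ 2 < 0 := by
          have : (n : ℝ) ≠ 0 := by exact_mod_cast hn
          have := pi_pos
          rw [neg_mul, neg_lt_zero]
          positivity
        exact (hw.const_mul_atTop_of_neg hn').congr fun x ↦ by ring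
    · filter_upwards [hw.eventually_ge_atTop 1] with x hx n
      rw [norm_cexp_neg_quadratic, Real.exp_le_exp]
      have := mul_le_mul_of_nonneg_left hx (by positivity : 0 ≤ π * (n : ℝ) ^ 2)
      linarith
  rw [tsum_ite_eq] at key
  refine key.congr' ?_
  filter_upwards [hw.eventually_gt_atTop 0] with x hx
  rw [Complex.tsum_exp_neg_quadratic hx]
  congr! 6 with n
  linear_combination (-(c : ℂ)) * Complex.I_sq

theorem tsum_int_eq_sum_tsum_residue {m : ℕ} [NeZero m] {f : ℤ → ℂ} (hf : Summable f) :
    ∑' n, f n = ∑ r : Fin m, ∑' j : ℤ, f (j * m + r) := by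
  have hf' : Summable fun p : ℤ × Fin m ↦ f (p.1 * m + p.2) :=
    (Int.divModEquiv m).symm.summable_iff.mpr hf
  have := hf'.prod_symm.tsum_prod
  rw [tsum_fintype (β := Fin m)] at this
  exact ((Int.divModEquiv m).symm.tsum_eq f).symm.trans <|
    ((Equiv.prodComm (Fin m) ℤ).tsum_eq fun p : ℤ × Fin m ↦ f (p.1 * m + p.2)).symm.trans this

theorem ofReal_mul_cpow {r : ℝ} (hr : 0 < r) {z : ℂ} (hz : z ≠ 0) (s : ℂ) :
    ((r : ℂ) * z) ^ s = (r : ℂ) ^ s * z ^ s := by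
  have hr' : (r : ℂ) ≠ 0 := by exact_mod_cast hr.ne'
  rw [Complex.cpow_def_of_ne_zero (mul_ne_zero hr' hz), Complex.cpow_def_of_ne_zero hr',
    Complex.cpow_def_of_ne_zero hz, Complex.log_ofReal_mul hr hz, ← Complex.ofReal_log hr.le,
    add_mul, Complex.exp_add]

theorem I_div_cpow_half {m : ℝ} (hm : 0 < m) :
    (I / m) ^ (1 / 2 : ℂ) = Complex.exp (I * π / 4) / (√m : ℝ) := by
  have : (I / m : ℂ) = ((m⁻¹ : ℝ) : ℂ) * I := by push_cast; field_simp
  have hsqrt : ((m⁻¹ : ℝ) : ℂ) ^ (1 / 2 : ℂ) = ((√m : ℝ) : ℂ)⁻¹ := by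
    rw [← Complex.ofReal_inv, ← sqrt_inv, sqrt_eq_rpow, Complex.ofReal_cpow (inv_pos.mpr hm).le]
    norm_num
  rw [this, ofReal_mul_cpow (inv_pos.mpr hm) Complex.I_ne_zero, hsqrt,
    Complex.cpow_def_of_ne_zero Complex.I_ne_zero, Complex.log_I, div_eq_inv_mul (Complex.exp _)]
  congr 2
  ring

theorem even_sq_mul_add_mul {m k : ℤ} (hk : Even (m + k)) (j : ℤ) : Even (j ^ 2 * m + k * j) := by
  have : j ^ 2 * m + k * j = j * (j - 1) * m + j * (m + k) := by ring
  rw [this]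
  exact ((Int.even_mul_pred_self j).mul_right m).add (hk.mul_left j)

/-- The `n`-th term of the quadratic Gauss sum with parameters `m` and `k`. -/
noncomputable def quadraticGaussTerm (m : ℕ) (k n : ℤ) : ℂ :=
  Complex.exp (-(I * (π : ℂ) * (n : ℂ) ^ 2 / (m : ℂ)) - I * (π : ℂ) * (k : ℂ) * (n : ℂ) / (m : ℂ))

theorem norm_quadraticGaussTerm (m : ℕ) (k n : ℤ) : ‖quadraticGaussTerm m k n‖ = 1 := by
  have h : -(I * (π : ℂ) * (n : ℂ) ^ 2 / (m : ℂ)) - I * (π : ℂ) * (k : ℂ) * (n : ℂ) / (m : ℂ)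
      = ((-(π * n ^ 2 / m) - π * k * n / m : ℝ) : ℂ) * I := by
    push_cast; ring
  rw [quadraticGaussTerm, h, Complex.norm_exp_ofReal_mul_I]

theorem quadraticGaussTerm_mul_add {m : ℕ} (hm : 0 < m) {k : ℤ} (hk : Even ((m : ℤ) + k))
    (j r : ℤ) : quadraticGaussTerm m k (j * m + r) = quadraticGaussTerm m k r := by
  obtain ⟨N, hN⟩ := even_sq_mul_add_mul hk j
  have hN' : (j : ℂ) ^ 2 * m + k * j = N + N := by exact_mod_cast hN
  have hm' : (m : ℂ) ≠ 0 := by exact_mod_cast hm.ne'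
  refine Complex.exp_eq_exp_iff_exists_int.mpr ⟨-(j * r + N), ?_⟩
  push_cast
  field_simp
  linear_combination (-(m : ℂ)) * hN'

theorem sum_Icc_quadraticGaussTerm {m : ℕ} (hm : 0 < m) {k : ℤ} (hk : Even ((m : ℤ) + k)) :
    ∑ n ∈ Finset.Icc 1 m, quadraticGaussTerm m k n = ∑ r : Fin m, quadraticGaussTerm m k r := by
  have h := quadraticGaussTerm_mul_add hm hk 1 0
  have h2 := Finset.sum_range_succ (fun n : ℕ ↦ quadraticGaussTerm m k n) m
  rw [Finset.sum_range_eq_add_Ico _ (Nat.succ_pos m)] at h2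
  rw [← Fin.sum_univ_eq_sum_range (fun n : ℕ ↦ quadraticGaussTerm m k n)] at h2
  simp only [one_mul, add_zero] at h
  rw [h, add_comm] at h2
  exact add_right_cancel h2

/-- The Gauss sum smoothed by `exp (-π n² / (v m²))`, with `v → ∞` removing the smoothing. -/
noncomputable def smoothedGaussSum (m : ℕ) (k : ℤ) (v : ℝ) : ℂ :=
  ∑' n : ℤ, quadraticGaussTerm m k n * Complex.exp (-π / (v * m ^ 2) * n ^ 2)

theorem smoothedGaussSum_eq_sum_residue {m : ℕ} (hm : 0 < m) {k : ℤ} (hk : Even ((m : ℤ) + k))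
    {v : ℝ} (hv : 0 < v) :
    smoothedGaussSum m k v = ∑ r : Fin m, quadraticGaussTerm m k r *
      ∑' j : ℤ, Complex.exp (-π / v * (j + ((r / m : ℝ) : ℂ)) ^ 2) := by
  have : NeZero m := ⟨hm.ne'⟩
  have hm' : (m : ℂ) ≠ 0 := by exact_mod_cast hm.ne'
  have hv' : (v : ℂ) ≠ 0 := by exact_mod_cast hv.ne'
  have hs : Summable fun n : ℤ ↦
      quadraticGaussTerm m k n * Complex.exp (-π / (v * m ^ 2) * n ^ 2) := by
    refine .of_norm ((summable_exp_neg_mul_int_sq (a := 1 / (v * m ^ 2)) (by positivity)).congr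
      fun n ↦ ?_)
    have h : (-π / (v * m ^ 2) * n ^ 2 : ℂ) = ((-π * (1 / (v * m ^ 2)) * n ^ 2 : ℝ) : ℂ) := by
      push_cast; ring
    rw [norm_mul, norm_quadraticGaussTerm, one_mul, h, Complex.norm_exp_ofReal]
  rw [smoothedGaussSum, tsum_int_eq_sum_tsum_residue (m := m) hs]
  refine Finset.sum_congr rfl fun r _ ↦ ?_
  rw [← tsum_mul_left]
  refine tsum_congr fun j ↦ ?_
  rw [quadraticGaussTerm_mul_add hm hk]
  congr 2
  push_cast
  field_simp

theorem smoothedGaussSum_eq_dual {m : ℕ} (hm : 0 < m) {k : ℤ} (hk : Even ((m : ℤ) + k))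
    {v : ℝ} (hv : 0 < v) :
    smoothedGaussSum m k v = 1 / (I / m * ((v - I / m) / v)) ^ (1 / 2 : ℂ) *
      (Complex.exp (I * π * k ^ 2 / (4 * m)) *
        ∑' n : ℤ, Complex.exp (-π / (v - I / m) * (n + ((k / (2 * m) : ℝ) : ℂ)) ^ 2)) := by
  have hm' : (m : ℂ) ≠ 0 := by exact_mod_cast hm.ne'
  have hv' : (v : ℂ) ≠ 0 := by exact_mod_cast hv.ne'
  have ha : I / m * ((v - I / m) / v) = ((1 / (v * m ^ 2) : ℝ) : ℂ) + ((1 / m : ℝ) : ℂ) * I := by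
    push_cast
    field_simp
    linear_combination (-1 : ℂ) * Complex.I_sq
  have hre : 0 < (I / m * ((v - I / m) / v) : ℂ).re := by
    rw [ha, Complex.add_re, Complex.ofReal_re, Complex.re_ofReal_mul, Complex.I_re, mul_zero,
      add_zero]
    positivity
  have hw : (v - I / m : ℂ) ≠ 0 := by
    intro h
    rw [h] at hre
    simp at hre
  have hP := Complex.tsum_exp_neg_quadratic hre (-I * k / (2 * m))
  rw [smoothedGaussSum, ← tsum_mul_left]
  refine Eq.trans (tsum_congr fun n ↦ ?_) (hP.trans ?_)
  · rw [quadraticGaussTerm, ← Complex.exp_add, ha]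
    congr 1
    push_cast
    field_simp
    ring
  · congr 1
    refine tsum_congr fun n ↦ ?_
    obtain ⟨N, hN⟩ := even_sq_mul_add_mul hk n
    have hN' : (n : ℂ) ^ 2 * m + k * n = N + N := by exact_mod_cast hN
    rw [← Complex.exp_add]
    refine Complex.exp_eq_exp_iff_exists_int.mpr ⟨N, ?_⟩
    have h1 : (n + I * (-I * k / (2 * m)) : ℂ) = n + k / (2 * m) := by
      linear_combination (-(k / (2 * m) : ℂ)) * Complex.I_sq
    have h2 : (-π / (I / m * ((v - I / m) / v)) : ℂ) = I * π * m - π / (v - I / m) := by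
      have hvw : (v : ℂ) * m = (v - I / m) * m + I := by field_simp; ring
      generalize (v - I / m : ℂ) = w at hw hvw
      have := Complex.I_ne_zero
      field_simp
      linear_combination (-1 : ℂ) * hvw - w * m * Complex.I_sq
    rw [h1, h2]
    push_cast
    have h3 : (I * π * m * (n + k / (2 * m)) ^ 2 : ℂ)
        = I * π * k ^ 2 / (4 * m) + N * (2 * π * I) := by
      have : (I * π * m * (n + k / (2 * m)) ^ 2 : ℂ)
          = I * π * k ^ 2 / (4 * m) + I * π * (n ^ 2 * m + k * n) := by
        field_simp
        ring
      rw [this, hN']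
      ring
    linear_combination h3

theorem tendsto_smoothedGaussSum_residue {m : ℕ} (hm : 0 < m) {k : ℤ}
    (hk : Even ((m : ℤ) + k)) :
    Tendsto (fun v : ℝ ↦ 1 / (v : ℂ) ^ (1 / 2 : ℂ) * smoothedGaussSum m k v) atTop
      (𝓝 (∑ r : Fin m, quadraticGaussTerm m k r)) := by
  have h := tendsto_finsetSum (Finset.univ : Finset (Fin m)) fun r _ ↦
    (tendsto_tsum_exp_neg_div_mul_sq (w := fun v : ℝ ↦ (v : ℂ)) (l := atTop)
      (by simpa using! tendsto_id) (r / m : ℝ)).const_mul (quadraticGaussTerm m k r)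
  simp_rw [mul_one] at h
  refine h.congr' ?_
  filter_upwards [eventually_gt_atTop 0] with v hv
  rw [smoothedGaussSum_eq_sum_residue hm hk hv, Finset.mul_sum]
  exact Finset.sum_congr rfl fun r _ ↦ by ring

theorem tendsto_smoothedGaussSum_dual {m : ℕ} (hm : 0 < m) {k : ℤ}
    (hk : Even ((m : ℤ) + k)) :
    Tendsto (fun v : ℝ ↦ 1 / (v : ℂ) ^ (1 / 2 : ℂ) * smoothedGaussSum m k v) atTop
      (𝓝 (1 / (I / m) ^ (1 / 2 : ℂ) * Complex.exp (I * π * k ^ 2 / (4 * m)))) := by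
  have hm' : (m : ℂ) ≠ 0 := by exact_mod_cast hm.ne'
  have hIm : (I / m : ℂ) ≠ 0 := div_ne_zero Complex.I_ne_zero hm'
  have hre (v : ℝ) : (v - I / m : ℂ).re = v := by simp
  have hz : Tendsto (fun v : ℝ ↦ ((v - I / m) / v : ℂ)) atTop (𝓝 1) := by
    have h0 : Tendsto (fun v : ℝ ↦ ((v⁻¹ : ℝ) : ℂ)) atTop (𝓝 0) := by
      exact_mod_cast (Complex.continuous_ofReal.tendsto 0).comp tendsto_inv_atTop_zero
    have h1 := (h0.const_mul (I / m : ℂ)).const_sub 1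
    rw [mul_zero, sub_zero] at h1
    refine h1.congr' ?_
    filter_upwards [eventually_gt_atTop 0] with v hv
    have hv' : (v : ℂ) ≠ 0 := by exact_mod_cast hv.ne'
    push_cast
    field_simp
  have hslit : (I / m : ℂ) ∈ Complex.slitPlane := by
    refine Complex.mem_slitPlane_iff.mpr (Or.inr ?_)
    simpa using hm.ne'
  have ha : Tendsto (fun v : ℝ ↦ (I / m * ((v - I / m) / v) : ℂ) ^ (1 / 2 : ℂ)) atTop
      (𝓝 ((I / m) ^ (1 / 2 : ℂ))) := by
    have := hz.const_mul (I / m : ℂ)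
    rw [mul_one] at this
    exact this.cpow tendsto_const_nhds hslit
  have hb := hz.cpow (tendsto_const_nhds (x := (1 / 2 : ℂ))) Complex.one_mem_slitPlane
  rw [Complex.one_cpow] at hb
  have hθ := tendsto_tsum_exp_neg_div_mul_sq (w := fun v : ℝ ↦ (v - I / m : ℂ)) (l := atTop)
    (by simpa only [hre] using! tendsto_id) (k / (2 * m) : ℝ)
  have hne : (I / m : ℂ) ^ (1 / 2 : ℂ) ≠ 0 := by simp [Complex.cpow_eq_zero_iff, hIm]
  have h := ((tendsto_const_nhds (x := (1 : ℂ))).div ha hne).mul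
    ((hb.mul hθ).const_mul (Complex.exp (I * π * k ^ 2 / (4 * m))))
  rw [mul_one, mul_one] at h
  refine h.congr' ?_
  filter_upwards [eventually_gt_atTop 0] with v hv
  have hv' : (v : ℂ) ≠ 0 := by exact_mod_cast hv.ne'
  have hw : (v - I / m : ℂ) ≠ 0 := fun h ↦ hv.ne' (by rw [← hre v, h, Complex.zero_re])
  have hwv : (v - I / m : ℂ) ^ (1 / 2 : ℂ)
      = (v : ℂ) ^ (1 / 2 : ℂ) * ((v - I / m) / v) ^ (1 / 2 : ℂ) := by
    rw [← ofReal_mul_cpow hv (div_ne_zero hw hv'), mul_div_cancel₀ _ hv']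
  have hzne : ((v - I / m) / v : ℂ) ^ (1 / 2 : ℂ) ≠ 0 := by
    rw [Complex.cpow_ne_zero_iff]
    exact Or.inl (div_ne_zero hw hv')
  have hcancel : ((v - I / m) / v : ℂ) ^ (1 / 2 : ℂ) * (1 / (v - I / m : ℂ) ^ (1 / 2 : ℂ))
      = 1 / (v : ℂ) ^ (1 / 2 : ℂ) := by
    rw [hwv, ← div_div, mul_div_cancel₀ _ hzne]
  rw [smoothedGaussSum_eq_dual hm hk hv, Pi.div_apply, ← mul_assoc _ (1 / _) (tsum _), hcancel]
  ring

/-- **Evaluation of a quadratic Gauss sum**: for a positive integer `m` and an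
integer `k` with `m + k` even,
`Σ_{n=1}^m e^{-iπn²/m - iπkn/m} = e^{(iπ/4)(k²/m - 1)} √m`. -/
theorem quadratic_gauss_sum_eval (m : ℕ) (hm : 0 < m) (k : ℤ)
    (hk : Even ((m : ℤ) + k)) :
    (∑ n ∈ Finset.Icc 1 m,
        Complex.exp (-(I * (π : ℂ) * (n : ℂ) ^ 2 / (m : ℂ))
          - I * (π : ℂ) * (k : ℂ) * (n : ℂ) / (m : ℂ)))
      = Complex.exp ((I * (π : ℂ) / 4) * ((k : ℂ) ^ 2 / (m : ℂ) - 1))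
          * ((Real.sqrt m : ℝ) : ℂ) := by
  have hm' : (0 : ℝ) < m := by exact_mod_cast hm
  have h := tendsto_nhds_unique (tendsto_smoothedGaussSum_residue hm hk)
    (tendsto_smoothedGaussSum_dual hm hk)
  have hI := I_div_cpow_half hm'
  rw [Complex.ofReal_natCast] at hI
  rw [← sum_Icc_quadraticGaussTerm hm hk, hI, one_div_div, div_mul_eq_mul_div, mul_div_assoc,
    ← Complex.exp_sub, mul_comm] at h
  simp only [quadraticGaussTerm, Int.cast_natCast] at h
  rw [h]
  congr 2
  ring
end
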